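/- Let μ ∈ ℂ with Re μ < 1/2 and let γ ∈ (3/2, min(2, 2−Re μ)). For x ∈ ℝ, ε ∈ (0,1) and y > 0 define Ψ_ε(x,y) = (1/(2πi)) ∫_{γ−i∞}^{γ+i∞} [Γ(ε+s−3/2+ix) Γ(ε+s−3/2−ix) Γ(s−1) Γ(2−s) Γ(2−s−μ) / (Γ(s+ε−1) Γ(3/2−s) Γ(s−μ−1))] y^{−s} ds. Then there exists a constant C > 0, independent of ε ∈ (0,1), x ∈ ℝ and y > 0, such that |Ψ_ε(x,y)| ≤ C y^{−γ} for all such ε, x, y. -/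

import Mathlib

open MeasureTheory Set Complex

/-- The kernel `Ψ_ε(x,y)` of formula (3.10), a Mellin–Barnes integral along `Re s = γ`. -/
noncomputable def PsiEps (μ : ℂ) (γ ε x : ℝ) (y : ℝ) : ℂ :=
  (1 / (2 * Real.pi)) • ∫ t : ℝ,
    (fun s : ℂ =>
      Complex.Gamma ((ε : ℂ) + s - 3/2 + Complex.I * (x : ℂ)) *
        Complex.Gamma ((ε : ℂ) + s - 3/2 - Complex.I * (x : ℂ)) *
        Complex.Gamma (s - 1) * Complex.Gamma (2 - s) * Complex.Gamma (2 - s - μ) /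
        (Complex.Gamma (s + (ε : ℂ) - 1) * Complex.Gamma (3/2 - s) *
          Complex.Gamma (s - μ - 1)) * (y : ℂ) ^ (-s))
      ((γ : ℂ) + (t : ℂ) * Complex.I)

/-- Comparison of products of Gamma values at complex and at real arguments, from the Beta
integral. -/
theorem norm_Gamma_mul_Gamma_le {u v : ℂ} (hu : 0 < u.re) (hv : 0 < v.re) :
    ‖Gamma u‖ * ‖Gamma v‖ * Real.Gamma (u.re + v.re) ≤
      Real.Gamma u.re * Real.Gamma v.re * ‖Gamma (u + v)‖ := by
  have key : ‖betaIntegral u v‖ ≤ ‖betaIntegral (u.re : ℂ) (v.re : ℂ)‖ := by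
    have hreal : betaIntegral (u.re : ℂ) (v.re : ℂ) =
        ((∫ x : ℝ in (0 : ℝ)..1, ‖(x : ℂ) ^ (u - 1) * (1 - (x : ℂ)) ^ (v - 1)‖ : ℝ) : ℂ) := by
      rw [betaIntegral, ← intervalIntegral.integral_ofReal,
        intervalIntegral.integral_of_le zero_le_one, intervalIntegral.integral_of_le zero_le_one,
        integral_Ioc_eq_integral_Ioo, integral_Ioc_eq_integral_Ioo]
      refine setIntegral_congr_fun measurableSet_Ioo fun x hx ↦ ?_
      have hx1 : 0 < 1 - x := sub_pos.mpr hx.2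
      have h1 : (1 - (x : ℂ)) = ((1 - x : ℝ) : ℂ) := by push_cast; rfl
      simp only [h1, norm_mul]
      rw [norm_cpow_eq_rpow_re_of_pos hx.1, norm_cpow_eq_rpow_re_of_pos hx1, ofReal_mul,
        ofReal_cpow hx.1.le, ofReal_cpow hx1.le]
      simp
    rw [hreal, norm_real]
    exact (intervalIntegral.norm_integral_le_integral_norm zero_le_one).trans (le_abs_self _)
  have h1 := Gamma_mul_Gamma_eq_betaIntegral hu hv
  have h2 := Gamma_mul_Gamma_eq_betaIntegral (s := (u.re : ℂ)) (t := (v.re : ℂ))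
    (by simpa using hu) (by simpa using hv)
  have h1' := congrArg norm h1
  have h2' := congrArg norm h2
  rw [← ofReal_add] at h2'
  simp only [norm_mul, Gamma_ofReal, norm_real, Real.norm_eq_abs,
    abs_of_pos (Real.Gamma_pos_of_pos hu), abs_of_pos (Real.Gamma_pos_of_pos hv),
    abs_of_pos (Real.Gamma_pos_of_pos (add_pos hu hv))] at h1' h2'
  rw [h1', h2']
  have hG := (Real.Gamma_pos_of_pos (add_pos hu hv)).le
  calc _ = (Real.Gamma (u.re + v.re) * ‖Gamma (u + v)‖) * ‖betaIntegral u v‖ := by ring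
    _ ≤ (Real.Gamma (u.re + v.re) * ‖Gamma (u + v)‖) * ‖betaIntegral (u.re : ℂ) (v.re : ℂ)‖ := by
      gcongr
    _ = _ := by ring

/-- On a horizontal line in the right half-plane, `‖Γ z‖ / Γ (re z)` is nondecreasing. -/
theorem norm_Gamma_mul_Gamma_re_le {z w : ℂ} (hz : 0 < z.re) (hzw : z.re < w.re)
    (him : z.im = w.im) :
    ‖Gamma z‖ * Real.Gamma w.re ≤ Real.Gamma z.re * ‖Gamma w‖ := by
  have hd : 0 < w.re - z.re := sub_pos.mpr hzw
  have hG := Real.Gamma_pos_of_pos hd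
  have h := norm_Gamma_mul_Gamma_le (u := z) (v := ((w.re - z.re : ℝ) : ℂ)) hz (by simpa using hzw)
  have hw : z + ((w.re - z.re : ℝ) : ℂ) = w := by
    apply Complex.ext <;> simp [him]
  rw [hw, Gamma_ofReal, norm_real, Real.norm_of_nonneg hG.le, ofReal_re,
    add_sub_cancel] at h
  refine le_of_mul_le_mul_right ?_ hG
  linarith

theorem norm_Gamma_half_add_mul_I_sq (t : ℝ) :
    ‖Gamma (1 / 2 + t * I)‖ ^ 2 = Real.pi / Real.cosh (Real.pi * t) := by
  have h := congrArg norm (Gamma_mul_Gamma_one_sub (1 / 2 + t * I))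
  have hc : (1 - (1 / 2 + t * I) : ℂ) = (starRingEnd ℂ) (1 / 2 + t * I) := by
    apply Complex.ext
    · simp; norm_num
    · simp
  have hs : Complex.sin (Real.pi * (1 / 2 + t * I)) = (Real.cosh (Real.pi * t) : ℂ) := by
    rw [show (Real.pi * (1 / 2 + t * I) : ℂ) = (Real.pi * t : ℂ) * I + Real.pi / 2 by ring,
      Complex.sin_add_pi_div_two, Complex.cos_mul_I]
    push_cast; rfl
  rw [hc, Gamma_conj, hs, norm_mul, norm_conj, norm_div, norm_real, norm_real,
    Real.norm_of_nonneg Real.pi_pos.le, Real.norm_of_nonneg (Real.cosh_pos _).le] at h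
  rw [sq, h]

theorem exp_abs_le_two_mul_cosh (x : ℝ) : Real.exp |x| ≤ 2 * Real.cosh x := by
  rw [← Real.cosh_abs, Real.cosh_eq]
  linarith [Real.exp_pos (-|x|)]

theorem exists_norm_Gamma_nat_add_half_le (n : ℕ) {θ : ℝ} (hθ : θ < Real.pi / 2) :
    ∃ C > 0, ∀ t : ℝ, ‖Gamma (n + 1 / 2 + t * I)‖ ≤ C * Real.exp (-θ * |t|) := by
  induction n generalizing θ with
  | zero =>
    refine ⟨√(2 * Real.pi), by positivity, fun t ↦ ?_⟩
    have h1 : ‖Gamma (1 / 2 + t * I)‖ ^ 2 ≤ (√(2 * Real.pi) * Real.exp (-θ * |t|)) ^ 2 := by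
      rw [norm_Gamma_half_add_mul_I_sq, mul_pow, Real.sq_sqrt (by positivity),
        div_le_iff₀ (Real.cosh_pos _), ← Real.exp_nat_mul]
      have h2 := exp_abs_le_two_mul_cosh (Real.pi * t)
      rw [abs_mul, abs_of_pos Real.pi_pos] at h2
      have h3 : (1 : ℝ) ≤ Real.exp ((2 : ℕ) * (-θ * |t|)) * Real.exp (Real.pi * |t|) := by
        rw [← Real.exp_add]
        apply Real.one_le_exp
        push_cast
        nlinarith [abs_nonneg t]
      nlinarith [Real.pi_pos, mul_le_mul_of_nonneg_left h2
        (Real.exp_pos ((2 : ℕ) * (-θ * |t|))).le]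
    have := (sq_le_sq₀ (norm_nonneg _) (by positivity)).mp h1
    simpa using this
  | succ n ih =>
    obtain ⟨θ', h1, h2⟩ := exists_between hθ
    obtain ⟨C, hC, h⟩ := ih h2
    have hδ : 0 < θ' - θ := sub_pos.mpr h1
    refine ⟨(n + 1 / 2 + 1 / (θ' - θ)) * C, by positivity, fun t ↦ ?_⟩
    have hz : (n + 1 / 2 + t * I : ℂ) ≠ 0 := by
      intro h0
      have := congrArg re h0
      simp at this
      have h3 : (0 : ℝ) ≤ n := n.cast_nonneg
      linarith
    have hrec : Gamma ((n + 1 : ℕ) + 1 / 2 + t * I) =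
        (n + 1 / 2 + t * I) * Gamma (n + 1 / 2 + t * I) := by
      rw [← Gamma_add_one _ hz]; congr 1; push_cast; ring
    have hnorm : ‖(n + 1 / 2 + t * I : ℂ)‖ ≤ (n + 1 / 2) + |t| := by
      refine (norm_add_le _ _).trans ?_
      have h4 : (n + 1 / 2 : ℂ) = ((n + 1 / 2 : ℝ) : ℂ) := by push_cast; rfl
      rw [h4, norm_real, Real.norm_of_nonneg (by positivity)]
      simp
    have he1 : 1 ≤ Real.exp ((θ' - θ) * |t|) := Real.one_le_exp (by positivity)
    have he2 : |t| ≤ 1 / (θ' - θ) * Real.exp ((θ' - θ) * |t|) := by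
      rw [one_div, ← div_eq_inv_mul, le_div_iff₀ hδ]
      nlinarith [Real.add_one_le_exp ((θ' - θ) * |t|)]
    have hpoly : ‖(n + 1 / 2 + t * I : ℂ)‖ ≤
        (n + 1 / 2 + 1 / (θ' - θ)) * Real.exp ((θ' - θ) * |t|) := by
      have h5 : (n + 1 / 2 : ℝ) ≤ (n + 1 / 2 : ℝ) * Real.exp ((θ' - θ) * |t|) :=
        le_mul_of_one_le_right (by positivity) he1
      linarith
    calc ‖Gamma ((n + 1 : ℕ) + 1 / 2 + t * I)‖
        = ‖(n + 1 / 2 + t * I : ℂ)‖ * ‖Gamma (n + 1 / 2 + t * I)‖ := by rw [hrec, norm_mul]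
      _ ≤ ((n + 1 / 2 + 1 / (θ' - θ)) * Real.exp ((θ' - θ) * |t|)) *
          (C * Real.exp (-θ' * |t|)) :=
        mul_le_mul hpoly (h t) (norm_nonneg _) (by positivity)
      _ = (n + 1 / 2 + 1 / (θ' - θ)) * C *
          (Real.exp ((θ' - θ) * |t|) * Real.exp (-θ' * |t|)) := by ring
      _ = _ := by rw [← Real.exp_add]; congr 2; ring

/-- Exponential decay of `Γ` on vertical lines, uniform for bounded positive real part. -/
theorem exists_norm_Gamma_le (B : ℝ) {θ : ℝ} (hθ : θ < Real.pi / 2) :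
    ∃ C > 0, ∀ z : ℂ, 0 < z.re → z.re ≤ B →
      ‖Gamma z‖ ≤ C * Real.Gamma z.re * Real.exp (-θ * |z.im|) := by
  obtain ⟨n, hn⟩ := exists_nat_gt B
  obtain ⟨C, hC, h⟩ := exists_norm_Gamma_nat_add_half_le n hθ
  have hG : 0 < Real.Gamma (n + 1 / 2) := Real.Gamma_pos_of_pos (by positivity)
  refine ⟨C / Real.Gamma (n + 1 / 2), by positivity, fun z hz hzB ↦ ?_⟩
  have hre : (n + 1 / 2 + z.im * I : ℂ).re = n + 1 / 2 := by simp
  have h1 := norm_Gamma_mul_Gamma_re_le (z := z) (w := n + 1 / 2 + z.im * I) hz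
    (by rw [hre]; linarith) (by simp)
  rw [hre, ← le_div_iff₀ hG] at h1
  have hGz := Real.Gamma_pos_of_pos hz
  calc ‖Gamma z‖ ≤ _ := h1
    _ ≤ Real.Gamma z.re * (C * Real.exp (-θ * |z.im|)) / Real.Gamma (n + 1 / 2) := by
      gcongr; exact h z.im
    _ = _ := by ring

theorem norm_sin_le_exp_abs_im (z : ℂ) : ‖Complex.sin z‖ ≤ Real.exp |z.im| := by
  have h1 : ‖Complex.exp (-z * I)‖ ≤ Real.exp |z.im| := by
    rw [norm_exp]; simpa using le_abs_self z.im
  have h2 : ‖Complex.exp (z * I)‖ ≤ Real.exp |z.im| := by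
    rw [norm_exp]; simpa using neg_le_abs z.im
  rw [Complex.sin, norm_div, norm_mul, norm_I, mul_one, Complex.norm_ofNat]
  linarith [norm_sub_le (Complex.exp (-z * I)) (Complex.exp (z * I))]

theorem norm_inv_Gamma_le {z : ℂ} (hz : z.re < 1) :
    ‖(Gamma z)⁻¹‖ ≤ ‖Gamma (1 - z)‖ * Real.exp (Real.pi * |z.im|) := by
  rcases eq_or_ne (Gamma z) 0 with h0 | h0
  · rw [h0]; simp; positivity
  have hG : Gamma (1 - z) ≠ 0 := Gamma_ne_zero_of_re_pos (by simpa using hz)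
  have h := Gamma_mul_Gamma_one_sub z
  have hs : Complex.sin (Real.pi * z) ≠ 0 := by
    intro hs
    rw [hs, div_zero] at h
    exact mul_ne_zero h0 hG h
  have hpi : (Real.pi : ℂ) ≠ 0 := ofReal_ne_zero.mpr Real.pi_ne_zero
  have heq : (Gamma z)⁻¹ = Gamma (1 - z) * Complex.sin (Real.pi * z) / Real.pi := by
    rw [eq_div_iff hs] at h
    rw [eq_div_iff hpi, inv_mul_eq_iff_eq_mul₀ h0, ← mul_assoc]
    exact h.symm
  rw [heq, norm_div, norm_mul, norm_real, Real.norm_of_nonneg Real.pi_pos.le]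
  have hsin := norm_sin_le_exp_abs_im (Real.pi * z)
  rw [im_ofReal_mul, abs_mul, abs_of_pos Real.pi_pos] at hsin
  refine (div_le_self (by positivity) (by linarith [Real.pi_gt_three])).trans ?_
  gcongr

theorem exists_norm_inv_Gamma_le (b : ℝ) {θ : ℝ} (hθ : θ < Real.pi / 2) :
    ∃ C > 0, ∀ z : ℂ, z.re = b →
      ‖(Gamma z)⁻¹‖ ≤ C * Real.exp ((Real.pi - θ) * |z.im|) := by
  have small : ∀ b : ℝ, b < 1 → ∃ C > 0, ∀ z : ℂ, z.re = b →
      ‖(Gamma z)⁻¹‖ ≤ C * Real.exp ((Real.pi - θ) * |z.im|) := by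
    intro b hb
    obtain ⟨C, hC, h⟩ := exists_norm_Gamma_le (1 - b) hθ
    have hG : 0 < Real.Gamma (1 - b) := Real.Gamma_pos_of_pos (by linarith)
    refine ⟨C * Real.Gamma (1 - b), by positivity, fun z hz ↦ ?_⟩
    have h1 := h (1 - z) (by simp; linarith) (by simp [hz])
    simp only [sub_re, one_re, sub_im, one_im, zero_sub, abs_neg, hz] at h1
    calc ‖(Gamma z)⁻¹‖ ≤ ‖Gamma (1 - z)‖ * Real.exp (Real.pi * |z.im|) :=
          norm_inv_Gamma_le (by linarith)
      _ ≤ (C * Real.Gamma (1 - b) * Real.exp (-θ * |z.im|)) * Real.exp (Real.pi * |z.im|) := by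
          gcongr
      _ = C * Real.Gamma (1 - b) * (Real.exp (-θ * |z.im|) * Real.exp (Real.pi * |z.im|)) := by
          ring
      _ = _ := by rw [← Real.exp_add]; congr 2; ring
  rcases lt_or_ge b 1 with hb | hb
  · exact small b hb
  obtain ⟨C, hC, h⟩ := small (1 / 2) (by norm_num)
  have hGb : 0 < Real.Gamma b := Real.Gamma_pos_of_pos (by linarith)
  have hGh : 0 < Real.Gamma (1 / 2) := Real.Gamma_pos_of_pos (by norm_num)
  refine ⟨Real.Gamma (1 / 2) / Real.Gamma b * C, by positivity, fun z hz ↦ ?_⟩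
  have hre : (1 / 2 + z.im * I : ℂ).re = 1 / 2 := by simp
  have him : (1 / 2 + z.im * I : ℂ).im = z.im := by simp
  have h1 := h (1 / 2 + z.im * I) hre
  have h2 := norm_Gamma_mul_Gamma_re_le (z := 1 / 2 + z.im * I) (w := z) (by rw [hre]; norm_num)
    (by rw [hre, hz]; linarith) him
  rw [hre, hz] at h2
  rw [him] at h1
  have hz0 : 0 < ‖Gamma z‖ := norm_pos_iff.mpr (Gamma_ne_zero_of_re_pos (by linarith))
  have hw0 : 0 < ‖Gamma (1 / 2 + z.im * I)‖ :=
    norm_pos_iff.mpr (Gamma_ne_zero_of_re_pos (by rw [hre]; norm_num))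
  calc ‖(Gamma z)⁻¹‖
      ≤ Real.Gamma (1 / 2) / Real.Gamma b * ‖(Gamma (1 / 2 + z.im * I))⁻¹‖ := by
        rw [norm_inv, norm_inv, ← one_div, div_mul_eq_mul_div, le_div_iff₀ hGb,
          div_mul_eq_mul_div, div_le_iff₀ hz0, mul_assoc, inv_mul_eq_div, mul_div_assoc',
          le_div_iff₀ hw0]
        linarith
    _ ≤ Real.Gamma (1 / 2) / Real.Gamma b * (C * Real.exp ((Real.pi - θ) * |z.im|)) := by
        gcongr
    _ = _ := by ring

/-- Bound, uniform in `x`, for a quotient of Gamma factors, from the duplication formula. -/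
theorem norm_Gamma_mul_Gamma_div_Gamma_add_half_le {z : ℂ} (hz : 0 < z.re) (x : ℝ) :
    ‖Gamma (z + I * x)‖ * ‖Gamma (z - I * x)‖ * ‖(Gamma (z + 1 / 2))⁻¹‖ ≤
      Real.Gamma z.re ^ 2 / Real.Gamma (2 * z.re) * (2 : ℝ) ^ (2 * z.re) * ‖Gamma z‖ := by
  have h := norm_Gamma_mul_Gamma_le (u := z + I * x) (v := z - I * x)
    (by simpa using hz) (by simpa using hz)
  have hsum : z + I * x + (z - I * x) = 2 * z := by ring
  simp only [hsum, add_re, sub_re, mul_re, I_re, I_im, ofReal_re, ofReal_im, zero_mul, mul_zero,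
    sub_zero, add_zero, ← two_mul] at h
  have hG2 : 0 < Real.Gamma (2 * z.re) := Real.Gamma_pos_of_pos (by linarith)
  have hhalf : 0 < ‖Gamma (z + 1 / 2)‖ :=
    norm_pos_iff.mpr (Gamma_ne_zero_of_re_pos (by simp; linarith))
  have hdup := congrArg norm (Gamma_mul_Gamma_add_half z)
  have hpow : ‖(2 : ℂ) ^ (1 - 2 * z)‖ = (2 : ℝ) ^ (1 - 2 * z.re) := by
    have := norm_cpow_eq_rpow_re_of_pos (x := 2) (by norm_num) (1 - 2 * z)
    simpa using this
  simp only [norm_mul] at hdup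
  rw [hpow, norm_real, Real.norm_of_nonneg (Real.sqrt_nonneg _)] at hdup
  have hdup' : ‖Gamma (2 * z)‖ ≤ (2 : ℝ) ^ (2 * z.re) * ‖Gamma z‖ * ‖Gamma (z + 1 / 2)‖ := by
    rw [mul_assoc, hdup, Real.rpow_sub (by norm_num), Real.rpow_one]
    have hp : (0 : ℝ) < 2 ^ (2 * z.re) := by positivity
    have hs : 1 ≤ √Real.pi := Real.one_le_sqrt.mpr (by linarith [Real.pi_gt_three])
    have : (2 : ℝ) ^ (2 * z.re) * (‖Gamma (2 * z)‖ * (2 / 2 ^ (2 * z.re)) * √Real.pi) =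
        ‖Gamma (2 * z)‖ * (2 * √Real.pi) := by
      field_simp
    rw [this]
    exact le_mul_of_one_le_right (norm_nonneg _) (by linarith)
  rw [norm_inv, ← div_eq_mul_inv, div_le_iff₀ hhalf]
  rw [← le_div_iff₀ hG2] at h
  calc _ ≤ _ := h
    _ ≤ Real.Gamma z.re * Real.Gamma z.re *
        ((2 : ℝ) ^ (2 * z.re) * ‖Gamma z‖ * ‖Gamma (z + 1 / 2)‖) / Real.Gamma (2 * z.re) := by
      have := Real.Gamma_pos_of_pos hz
      gcongr
    _ = _ := by ring

theorem integrable_exp_neg_mul_abs {c : ℝ} (hc : 0 < c) :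
    Integrable fun t : ℝ ↦ Real.exp (-c * |t|) := by
  rw [← integrableOn_univ, ← Iic_union_Ioi (a := (0 : ℝ))]
  refine IntegrableOn.union ?_ ?_
  · refine (integrableOn_exp_mul_Iic hc 0).congr_fun (fun t ht ↦ ?_) measurableSet_Iic
    simp [abs_of_nonpos (show t ≤ 0 from ht)]
  · refine (integrableOn_exp_mul_Ioi (neg_lt_zero.mpr hc) 0).congr_fun (fun t ht ↦ ?_)
      measurableSet_Ioi
    simp [abs_of_pos (show 0 < t from ht)]

/-- Uniform bound for the Gamma factors of the kernel on the line of integration. -/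
theorem exists_norm_kernel_le {μ : ℂ} {γ : ℝ} (h1 : 3 / 2 < γ) (h2 : γ < 2)
    (h3 : γ < 2 - μ.re) :
    ∃ K > (0 : ℝ), ∀ ε ∈ Set.Ioo (0 : ℝ) 1, ∀ x : ℝ, ∀ s : ℂ, s.re = γ →
      ‖Gamma ((ε : ℂ) + s - 3 / 2 + I * (x : ℂ)) * Gamma ((ε : ℂ) + s - 3 / 2 - I * (x : ℂ)) *
        Gamma (s - 1) * Gamma (2 - s) * Gamma (2 - s - μ) /
        (Gamma (s + (ε : ℂ) - 1) * Gamma (3 / 2 - s) * Gamma (s - μ - 1))‖ ≤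
      K * Real.exp (-(2 * Real.pi / 5) * |s.im|) := by
  have hθ : 2 * Real.pi / 5 < Real.pi / 2 := by linarith [Real.pi_pos]
  set θ := 2 * Real.pi / 5 with hθdef
  have hθ0 : 0 < θ := by positivity
  obtain ⟨C₁, hC₁, b₁⟩ := exists_norm_Gamma_le (γ + (2 - γ - μ.re)) hθ
  obtain ⟨C₂, hC₂, b₂⟩ := exists_norm_inv_Gamma_le (3 / 2 - γ) hθ
  obtain ⟨C₃, hC₃, b₃⟩ := exists_norm_inv_Gamma_le (γ - μ.re - 1) hθ
  have hcont : ContinuousOn (fun a : ℝ ↦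
      Real.Gamma a ^ 2 / Real.Gamma (2 * a) * (2 : ℝ) ^ (2 * a) * Real.Gamma a)
      (Set.Icc (γ - 3 / 2) (γ - 1 / 2)) := by
    have hΓ : ∀ a : ℝ, 0 < a → ContinuousAt Real.Gamma a := fun a ha ↦
      (Real.differentiableOn_Gamma_Ioi.differentiableAt (Ioi_mem_nhds ha)).continuousAt
    intro a ha
    have ha0 : 0 < a := by linarith [ha.1]
    have hΓ2 : ContinuousAt (fun a : ℝ ↦ Real.Gamma (2 * a)) a :=
      (hΓ (2 * a) (by linarith)).comp (f := fun a : ℝ ↦ 2 * a) (by fun_prop)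
    refine ContinuousAt.continuousWithinAt ?_
    refine ((((hΓ a ha0).pow 2).div hΓ2 (Real.Gamma_pos_of_pos (by linarith)).ne').mul ?_).mul
      (hΓ a ha0)
    exact ContinuousAt.rpow (by fun_prop) (by fun_prop) (Or.inl (by norm_num))
  obtain ⟨M, hM⟩ := isCompact_Icc.exists_bound_of_continuousOn hcont
  have hG1 : 0 < Real.Gamma (γ - 1) := Real.Gamma_pos_of_pos (by linarith)
  have hG2 : 0 < Real.Gamma (2 - γ) := Real.Gamma_pos_of_pos (by linarith)
  have hG3 : 0 < Real.Gamma (2 - γ - μ.re) := Real.Gamma_pos_of_pos (by linarith)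
  set m := |μ.im|
  refine ⟨(|M| + 1) * C₁ * (C₁ * Real.Gamma (γ - 1)) * (C₁ * Real.Gamma (2 - γ)) *
    (C₁ * Real.Gamma (2 - γ - μ.re) * Real.exp (θ * m)) * C₂ *
    (C₃ * Real.exp ((Real.pi - θ) * m)), by positivity, fun ε hε x s hs ↦ ?_⟩
  set z : ℂ := ε + s - 3 / 2 with hz
  have hzre : z.re = ε + γ - 3 / 2 := by simp [hz, hs]
  have hzim : z.im = s.im := by simp [hz]
  have hz0 : 0 < z.re := by linarith [hε.1]
  have hΓz := Real.Gamma_pos_of_pos hz0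
  have hΓ2z : 0 < Real.Gamma (2 * z.re) := Real.Gamma_pos_of_pos (by linarith)
  have e₁ : ‖Gamma (z + I * x)‖ * ‖Gamma (z - I * x)‖ * ‖(Gamma (s + ε - 1))⁻¹‖ ≤
      (|M| + 1) * C₁ * Real.exp (-θ * |s.im|) := by
    rw [show s + (ε : ℂ) - 1 = z + 1 / 2 by rw [hz]; ring]
    refine (norm_Gamma_mul_Gamma_div_Gamma_add_half_le hz0 x).trans ?_
    have hzM := hM z.re ⟨by linarith [hε.1], by linarith [hε.2]⟩
    have hzM' := (le_abs_self _).trans (hzM.trans ((le_abs_self M).trans (lt_add_one |M|).le))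
    have hb := b₁ z hz0 (by linarith [hε.2])
    rw [hzim] at hb
    calc _ ≤ Real.Gamma z.re ^ 2 / Real.Gamma (2 * z.re) * (2 : ℝ) ^ (2 * z.re) *
          (C₁ * Real.Gamma z.re * Real.exp (-θ * |s.im|)) := by gcongr
      _ = (Real.Gamma z.re ^ 2 / Real.Gamma (2 * z.re) * (2 : ℝ) ^ (2 * z.re) *
          Real.Gamma z.re) * C₁ * Real.exp (-θ * |s.im|) := by ring
      _ ≤ _ := by gcongr
  have e₂ : ‖Gamma (s - 1)‖ ≤ C₁ * Real.Gamma (γ - 1) * Real.exp (-θ * |s.im|) := by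
    have := b₁ (s - 1) (by simp; linarith) (by simp; linarith)
    simpa [hs] using this
  have e₃ : ‖Gamma (2 - s)‖ ≤ C₁ * Real.Gamma (2 - γ) * Real.exp (-θ * |s.im|) := by
    have := b₁ (2 - s) (by simp; linarith) (by simp; linarith)
    simpa [hs] using this
  have e₄ : ‖Gamma (2 - s - μ)‖ ≤
      C₁ * Real.Gamma (2 - γ - μ.re) * Real.exp (θ * m) * Real.exp (-θ * |s.im|) := by
    have := b₁ (2 - s - μ) (by simp; linarith) (by simp; linarith)
    have hre : (2 - s - μ).re = 2 - γ - μ.re := by simp [hs]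
    have him : |s.im| ≤ |(2 - s - μ).im| + m := by
      rw [show s.im = -((2 - s - μ).im + μ.im) by simp, abs_neg]
      exact abs_add_le _ _
    rw [hre] at this
    refine this.trans ?_
    rw [mul_assoc (C₁ * _), ← Real.exp_add]
    gcongr
    nlinarith
  have e₅ : ‖(Gamma (3 / 2 - s))⁻¹‖ ≤ C₂ * Real.exp ((Real.pi - θ) * |s.im|) := by
    have := b₂ (3 / 2 - s) (by simp [hs])
    simpa using this
  have e₆ : ‖(Gamma (s - μ - 1))⁻¹‖ ≤
      C₃ * Real.exp ((Real.pi - θ) * m) * Real.exp ((Real.pi - θ) * |s.im|) := by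
    have := b₃ (s - μ - 1) (by simp [hs])
    have him : |(s - μ - 1).im| ≤ |s.im| + m := by
      simpa using abs_sub s.im μ.im
    refine this.trans ?_
    rw [mul_assoc C₃, ← Real.exp_add]
    gcongr
    nlinarith [Real.pi_pos]
  have hexp : Real.exp (-θ * |s.im|) = Real.exp (-θ * |s.im|) * Real.exp (-θ * |s.im|) *
      Real.exp (-θ * |s.im|) * Real.exp (-θ * |s.im|) * Real.exp ((Real.pi - θ) * |s.im|) *
      Real.exp ((Real.pi - θ) * |s.im|) := by
    simp only [← Real.exp_add]
    congr 1
    rw [hθdef]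
    ring
  calc _ = (‖Gamma (z + I * x)‖ * ‖Gamma (z - I * x)‖ * ‖(Gamma (s + ε - 1))⁻¹‖) *
        ‖Gamma (s - 1)‖ * ‖Gamma (2 - s)‖ * ‖Gamma (2 - s - μ)‖ * ‖(Gamma (3 / 2 - s))⁻¹‖ *
        ‖(Gamma (s - μ - 1))⁻¹‖ := by
        simp only [norm_mul, norm_inv, div_eq_mul_inv, mul_inv]
        ring
    _ ≤ ((|M| + 1) * C₁ * Real.exp (-θ * |s.im|)) *
        (C₁ * Real.Gamma (γ - 1) * Real.exp (-θ * |s.im|)) *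
        (C₁ * Real.Gamma (2 - γ) * Real.exp (-θ * |s.im|)) *
        (C₁ * Real.Gamma (2 - γ - μ.re) * Real.exp (θ * m) * Real.exp (-θ * |s.im|)) *
        (C₂ * Real.exp ((Real.pi - θ) * |s.im|)) *
        (C₃ * Real.exp ((Real.pi - θ) * m) * Real.exp ((Real.pi - θ) * |s.im|)) := by
        gcongr
    _ = _ := by
        conv_rhs => rw [hexp]
        ring

/-- Uniform bound `|Ψ_ε(x,y)| ≤ C y^{−γ}` for `ε ∈ (0,1)`, `x ∈ ℝ` and `y > 0`. -/
theorem stmt13 (μ : ℂ) (hμ : μ.re < 1/2) (γ : ℝ)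
    (hγ : γ ∈ Set.Ioo (3/2 : ℝ) (min 2 (2 - μ.re))) :
    ∃ C > (0 : ℝ), ∀ ε ∈ Set.Ioo (0 : ℝ) 1, ∀ x : ℝ, ∀ y : ℝ, 0 < y →
      ‖PsiEps μ γ ε x y‖ ≤ C * y ^ (-γ) := by
  obtain ⟨K, hK, h⟩ := exists_norm_kernel_le (μ := μ) hγ.1 (lt_min_iff.mp hγ.2).1
    (lt_min_iff.mp hγ.2).2
  have hint := integrable_exp_neg_mul_abs (c := 2 * Real.pi / 5) (by positivity)
  set J := ∫ t : ℝ, Real.exp (-(2 * Real.pi / 5) * |t|) with hJ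
  have hJ0 : 0 ≤ J := integral_nonneg fun t ↦ (Real.exp_pos _).le
  refine ⟨1 / (2 * Real.pi) * (K * J) + 1, by positivity, fun ε hε x y hy ↦ ?_⟩
  have hy0 : 0 < y ^ (-γ) := Real.rpow_pos_of_pos hy _
  have hbound : ‖PsiEps μ γ ε x y‖ ≤ 1 / (2 * Real.pi) * (K * J * y ^ (-γ)) := by
    rw [PsiEps, norm_smul, Real.norm_of_nonneg (by positivity)]
    gcongr
    have hval : ∫ t : ℝ, K * Real.exp (-(2 * Real.pi / 5) * |t|) * y ^ (-γ) =
        K * J * y ^ (-γ) := by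
      rw [integral_mul_const, integral_const_mul]
    rw [← hval]
    refine norm_integral_le_of_norm_le ((hint.const_mul K).mul_const _)
      (Filter.Eventually.of_forall fun t ↦ ?_)
    have hk := h ε hε x (γ + t * I) (by simp)
    have him : ((γ : ℂ) + t * I).im = t := by simp
    rw [him] at hk
    beta_reduce
    rw [norm_mul, norm_cpow_eq_rpow_re_of_pos hy]
    have hre : (-((γ : ℂ) + t * I)).re = -γ := by simp
    rw [hre]
    gcongr
  linarith
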